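/- arXiv:2605.16614 — 2 statements merged into one kernel-verified Lean document; each statement's English description precedes it below -/
import Mathlib

section
/- Let φ ∈ (0, π/2) and let W_φ ∈ ℝ^4 be given by W_φ(q,p) = (1/4)(1 + (−1)^p cos φ + (−1)^{q+p} sin φ) for q,p ∈ {0,1}. Then for every f ∈ ℝ^4 with f(q,p) ≥ 0 for all (q,p) and Σ_{q,p} f(q,p) = 1, one has ‖W_φ − f‖₁ = Σ_{q,p} |W_φ(q,p) − f(q,p)| ≥ (cos φ + sin φ − 1)/2. -/
open Real Finset

noncomputable section

/-- The Wigner vector of the phase-gate state, as a function of (q,p) ∈ {0,1}² -/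
def Wphi (φ : ℝ) (q p : Fin 2) : ℝ :=
  (1/4) * (1 + (-1 : ℝ) ^ (p : ℕ) * Real.cos φ
    + (-1 : ℝ) ^ ((q : ℕ) + (p : ℕ)) * Real.sin φ)

/-- for φ ∈ (0, π/2), any entrywise-nonnegative f ∈ ℝ⁴ with entries
    summing to 1 satisfies ‖W_φ − f‖₁ ≥ (cos φ + sin φ − 1)/2. -/
theorem l1_lower_bound (φ : ℝ) (hφ : φ ∈ Set.Ioo 0 (Real.pi / 2))
    (f : Fin 2 → Fin 2 → ℝ)
    (hf_nonneg : ∀ q p : Fin 2, 0 ≤ f q p)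
    (hf_sum : ∑ q : Fin 2, ∑ p : Fin 2, f q p = 1) :
    (∑ q : Fin 2, ∑ p : Fin 2, |Wphi φ q p - f q p|) ≥
      (Real.cos φ + Real.sin φ - 1) / 2 := by
  have h01 := hf_nonneg 0 1
  simp only [Fin.sum_univ_two, Wphi] at *
  norm_num at *
  have a := le_abs_self (1 / 4 * (1 + Real.cos φ + Real.sin φ) - f 0 0)
  have b := neg_abs_le (1 / 4 * (1 + -Real.cos φ + -Real.sin φ) - f 0 1)
  have c := le_abs_self (1 / 4 * (1 + Real.cos φ + -Real.sin φ) - f 1 0)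
  have d := le_abs_self (1 / 4 * (1 + -Real.cos φ + Real.sin φ) - f 1 1)
  linarith

end
end

section
/- (C-formula, Lemma 2.1) For every φ ∈ ℝ, the Wigner distance of the state |φ⟩ = P(φ)|+⟩ = (|0⟩ + e^{iφ}|1⟩)/√2 satisfies C(|φ⟩⟨φ|) = (|sin φ| + |cos φ| − 1)/2. -/
open Complex Matrix Finset

noncomputable section

/-- Pauli X -/
def pauliX : Matrix (Fin 2) (Fin 2) ℂ := !![0, 1; 1, 0]
/-- Pauli Y -/
def pauliY : Matrix (Fin 2) (Fin 2) ℂ := !![0, -Complex.I; Complex.I, 0]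
/-- Pauli Z -/
def pauliZ : Matrix (Fin 2) (Fin 2) ℂ := !![1, 0; 0, -1]

/-- Phase-point operators A_{(q,p)} -/
def phasePoint (q p : Fin 2) : Matrix (Fin 2) (Fin 2) ℂ :=
  (1/2 : ℂ) • (1 + ((-1 : ℂ) ^ (p : ℕ)) • pauliX
    + ((-1 : ℂ) ^ ((q : ℕ) + (p : ℕ))) • pauliY + ((-1 : ℂ) ^ (q : ℕ)) • pauliZ)

/-- Wigner vector W_ρ(q,p) = (1/2) tr(ρ A_{(q,p)}) of a single-qubit operator -/
def wigner (ρ : Matrix (Fin 2) (Fin 2) ℂ) (q p : Fin 2) : ℝ :=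
  ((1/2 : ℂ) * (ρ * phasePoint q p).trace).re

/-- Wigner vector from a Bloch vector (x,y,z) -/
def wignerBloch (x y z : ℝ) : Fin 2 → Fin 2 → ℝ :=
  fun q p => (1/4) * (1 + (-1 : ℝ) ^ (p : ℕ) * x
    + (-1 : ℝ) ^ ((q : ℕ) + (p : ℕ)) * y + (-1 : ℝ) ^ (q : ℕ) * z)

/-- Wigner vectors of the six pure single-qubit stabilizer states
    (the Pauli eigenstates, Bloch vectors (±1,0,0), (0,±1,0), (0,0,±1)) -/
def stabWigners : Set (Fin 2 → Fin 2 → ℝ) :=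
  {wignerBloch 1 0 0, wignerBloch (-1) 0 0, wignerBloch 0 1 0,
   wignerBloch 0 (-1) 0, wignerBloch 0 0 1, wignerBloch 0 0 (-1)}

/-- The stabilizer polytope: convex hull of the six stabilizer Wigner vectors -/
def stabPolytope : Set (Fin 2 → Fin 2 → ℝ) := convexHull ℝ stabWigners

/-- ℓ₁ norm on ℝ⁴ -/
def l1norm (g : Fin 2 → Fin 2 → ℝ) : ℝ := ∑ q : Fin 2, ∑ p : Fin 2, |g q p|

/-- Wigner distance (magic monotone): C(ρ) = min_{f ∈ 𝒲_free} ‖W_ρ − f‖₁ -/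
def Cdist (ρ : Matrix (Fin 2) (Fin 2) ℂ) : ℝ :=
  sInf { d | ∃ f ∈ stabPolytope, d = l1norm (fun q p => wigner ρ q p - f q p) }

/-- the phase-gate state P(φ)|+⟩ = (|0⟩ + e^{iφ}|1⟩)/√2 -/
def phaseKet (φ : ℝ) : Fin 2 → ℂ :=
  fun j => (if j = 0 then 1 else Complex.exp (φ * Complex.I)) / Real.sqrt 2

/-- density matrix |φ⟩⟨φ| -/
def phaseRho (φ : ℝ) : Matrix (Fin 2) (Fin 2) ℂ :=
  fun j k => phaseKet φ j * star (phaseKet φ k)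

theorem wigner_phaseRho (φ : ℝ) :
    wigner (phaseRho φ) = wignerBloch (Real.cos φ) (Real.sin φ) 0 := by
  have h2 : ((Real.sqrt 2 : ℝ) : ℂ) * ((Real.sqrt 2 : ℝ) : ℂ) = 2 := by
    rw [← Complex.ofReal_mul, Real.mul_self_sqrt (by norm_num)]; norm_num
  have h2' : ((Real.sqrt 2 : ℝ) : ℂ) ≠ 0 := by
    intro h; rw [h] at h2; norm_num at h2
  have he : Complex.exp (φ * Complex.I) = Real.cos φ + Real.sin φ * Complex.I := by
    rw [Complex.exp_mul_I]; simp
  have key : ∀ a b : ℂ, a / ((Real.sqrt 2 : ℝ) : ℂ) * (b / ((Real.sqrt 2 : ℝ) : ℂ)) = a * b / 2 := by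
    intro a b; rw [div_mul_div_comm, h2]
  have hr : phaseRho φ = !![1/2, (Real.cos φ - Real.sin φ * Complex.I) / 2;
      (Real.cos φ + Real.sin φ * Complex.I) / 2, 1/2] := by
    have hs := Real.sin_sq_add_cos_sq φ
    have hs' : (Real.sin φ : ℂ)^2 + (Real.cos φ : ℂ)^2 = 1 := by exact_mod_cast hs
    ext i j
    fin_cases i <;> fin_cases j <;>
      simp only [phaseRho, phaseKet, he, star_div₀, Complex.star_def, Complex.conj_ofReal, key] <;>
      simp [-Complex.ofReal_cos, -Complex.ofReal_sin]
    · ring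
    · linear_combination (1/2 : ℂ) * hs' - (Real.sin φ : ℂ)^2 / 2 * Complex.I_sq
  funext q p
  rw [wigner, hr, wignerBloch]
  fin_cases q <;> fin_cases p <;>
    (simp only [Matrix.trace, Matrix.diag, Matrix.mul_apply, Fin.sum_univ_two, phasePoint, pauliX,
      pauliY, pauliZ, Matrix.add_apply, Matrix.smul_apply, Matrix.one_apply]
     simp [-Complex.ofReal_cos, -Complex.ofReal_sin]
     ring)

theorem polytope_bound {f : Fin 2 → Fin 2 → ℝ} (hf : f ∈ stabPolytope) :
    |f 0 0 - f 0 1 + f 1 0 - f 1 1| + |f 0 0 - f 0 1 - f 1 0 + f 1 1| ≤ 1 := by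
  have : stabPolytope ⊆ {f : Fin 2 → Fin 2 → ℝ |
      |f 0 0 - f 0 1 + f 1 0 - f 1 1| + |f 0 0 - f 0 1 - f 1 0 + f 1 1| ≤ 1} := by
    apply convexHull_min
    · intro g hg
      simp only [stabWigners, Set.mem_insert_iff, Set.mem_singleton_iff] at hg
      rcases hg with rfl | rfl | rfl | rfl | rfl | rfl <;>
        simp [wignerBloch] <;> norm_num [abs_le]
    · intro g hg k hk a b ha hb hab
      simp only [Set.mem_setOf_eq, Pi.add_apply, Pi.smul_apply, smul_eq_mul] at *
      have h1 := abs_add_le (a * (g 0 0 - g 0 1 + g 1 0 - g 1 1)) (b * (k 0 0 - k 0 1 + k 1 0 - k 1 1))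
      have h2 := abs_add_le (a * (g 0 0 - g 0 1 - g 1 0 + g 1 1)) (b * (k 0 0 - k 0 1 - k 1 0 + k 1 1))
      simp only [abs_mul, abs_of_nonneg ha, abs_of_nonneg hb] at h1 h2
      have e1 := mul_le_mul_of_nonneg_left hg ha
      have e2 := mul_le_mul_of_nonneg_left hk hb
      ring_nf at h1 h2 e1 e2 ⊢
      linarith
  exact this hf

theorem mem_polytope {x y : ℝ} (h : |x| + |y| = 1) : wignerBloch x y 0 ∈ stabPolytope := by
  have hx : ∃ s, (s = 1 ∨ s = -1) ∧ x = |x| * s := by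
    rcases abs_cases x with ⟨h, _⟩ | ⟨h, _⟩
    · exact ⟨1, Or.inl rfl, by rw [h]; ring⟩
    · exact ⟨-1, Or.inr rfl, by rw [h]; ring⟩
  have hy : ∃ s, (s = 1 ∨ s = -1) ∧ y = |y| * s := by
    rcases abs_cases y with ⟨h, _⟩ | ⟨h, _⟩
    · exact ⟨1, Or.inl rfl, by rw [h]; ring⟩
    · exact ⟨-1, Or.inr rfl, by rw [h]; ring⟩
  obtain ⟨s, hs, hx⟩ := hx
  obtain ⟨t, ht, hy⟩ := hy
  have m1 : wignerBloch s 0 0 ∈ stabPolytope := by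
    apply subset_convexHull
    rcases hs with rfl | rfl <;> simp [stabWigners]
  have m2 : wignerBloch 0 t 0 ∈ stabPolytope := by
    apply subset_convexHull
    rcases ht with rfl | rfl <;> simp [stabWigners]
  have := (convex_convexHull ℝ stabWigners) m1 m2 (abs_nonneg x) (abs_nonneg y) h
  change wignerBloch x y 0 ∈ convexHull ℝ stabWigners
  refine (congrArg (· ∈ convexHull ℝ stabWigners) ?_).mpr this
  funext q p
  simp only [wignerBloch, Pi.add_apply, Pi.smul_apply, smul_eq_mul]
  linear_combination (1/4) * (-1 : ℝ) ^ (p : ℕ) * hx + (1/4) * (-1 : ℝ) ^ ((q : ℕ) + (p : ℕ)) * hy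
    - (1/4) * h

theorem exists_shrink (x t : ℝ) (ht : 0 ≤ t) (h : t ≤ |x|) :
    ∃ x', |x'| = |x| - t ∧ |x - x'| = t := by
  rcases abs_cases x with ⟨e, _⟩ | ⟨e, _⟩
  · refine ⟨x - t, ?_, ?_⟩
    · rw [e, abs_of_nonneg]; linarith
    · rw [sub_sub_cancel, abs_of_nonneg ht]
  · refine ⟨x + t, ?_, ?_⟩
    · rw [e, abs_of_nonpos] <;> linarith
    · rw [sub_add_cancel_left, abs_neg, abs_of_nonneg ht]

/-- C-formula: C(|φ⟩⟨φ|) = (|sin φ| + |cos φ| − 1)/2 for every φ ∈ ℝ. -/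
theorem C_formula (φ : ℝ) :
    Cdist (phaseRho φ) = (|Real.sin φ| + |Real.cos φ| - 1) / 2 := by
  have hs := Real.sin_sq_add_cos_sq φ
  have hle : IsLeast { d | ∃ f ∈ stabPolytope, d = l1norm (fun q p => wigner (phaseRho φ) q p - f q p) }
      ((|Real.sin φ| + |Real.cos φ| - 1) / 2) := by
    rw [wigner_phaseRho]
    constructor
    · have s1 := Real.abs_sin_le_one φ
      have c1 := Real.abs_cos_le_one φ
      have s0 := abs_nonneg (Real.sin φ)
      have c0 := abs_nonneg (Real.cos φ)
      have ht : 0 ≤ (|Real.sin φ| + |Real.cos φ| - 1) / 2 := by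
        rw [← sq_abs (Real.sin φ), ← sq_abs (Real.cos φ)] at hs
        nlinarith
      obtain ⟨x, hx, hx'⟩ := exists_shrink (Real.cos φ) _ ht (by linarith)
      obtain ⟨y, hy, hy'⟩ := exists_shrink (Real.sin φ) _ ht (by linarith)
      refine ⟨wignerBloch x y 0, mem_polytope (by linarith), ?_⟩
      generalize (|Real.sin φ| + |Real.cos φ| - 1) / 2 = t at *
      simp only [l1norm, Fin.sum_univ_two, wignerBloch]
      norm_num
      have e1 : ∀ a b : ℝ, |a| = t → |b| = t →
          t = |(a + b) / 4| + |-(a + b) / 4| + (|(a - b) / 4| + |-(a - b) / 4|) := by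
        intro a b ha hb
        rcases (abs_eq ht).1 ha with rfl | rfl <;> rcases (abs_eq ht).1 hb with rfl | rfl <;>
          ring_nf <;> simp [abs_mul, abs_of_nonneg ht] <;> ring
      convert e1 _ _ hx' hy' using 4 <;> ring
    · rintro d ⟨f, hf, rfl⟩
      have hb := polytope_bound hf
      simp only [l1norm, Fin.sum_univ_two, wignerBloch]
      norm_num
      generalize Real.cos φ = x at *
      generalize Real.sin φ = y at *
      have hX : |x| ≤ |f 0 0 - f 0 1 + f 1 0 - f 1 1| + |x - (f 0 0 - f 0 1 + f 1 0 - f 1 1)| := by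
        have := abs_add_le (f 0 0 - f 0 1 + f 1 0 - f 1 1) (x - (f 0 0 - f 0 1 + f 1 0 - f 1 1))
        rwa [add_sub_cancel] at this
      have hY : |y| ≤ |f 0 0 - f 0 1 - f 1 0 + f 1 1| + |y - (f 0 0 - f 0 1 - f 1 0 + f 1 1)| := by
        have := abs_add_le (f 0 0 - f 0 1 - f 1 0 + f 1 1) (y - (f 0 0 - f 0 1 - f 1 0 + f 1 1))
        rwa [add_sub_cancel] at this
      have key : ∀ A B C D : ℝ, |A - B + C - D| ≤ |A| + |B| + (|C| + |D|) ∧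
          |A - B - C + D| ≤ |A| + |B| + (|C| + |D|) := by
        intro A B C D
        constructor <;> rw [abs_le] <;> constructor <;>
          linarith [le_abs_self A, neg_abs_le A, le_abs_self B, neg_abs_le B,
            le_abs_self C, neg_abs_le C, le_abs_self D, neg_abs_le D]
      have k1 := key (1 / 4 * (1 + x + y) - f 0 0) (1 / 4 * (1 + -x + -y) - f 0 1)
        (1 / 4 * (1 + x + -y) - f 1 0) (1 / 4 * (1 + -x + y) - f 1 1)
      have q1 : (1 / 4 * (1 + x + y) - f 0 0) - (1 / 4 * (1 + -x + -y) - f 0 1) +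
        (1 / 4 * (1 + x + -y) - f 1 0) - (1 / 4 * (1 + -x + y) - f 1 1) =
          x - (f 0 0 - f 0 1 + f 1 0 - f 1 1) := by ring
      have q2 : (1 / 4 * (1 + x + y) - f 0 0) - (1 / 4 * (1 + -x + -y) - f 0 1) -
        (1 / 4 * (1 + x + -y) - f 1 0) + (1 / 4 * (1 + -x + y) - f 1 1) =
          y - (f 0 0 - f 0 1 - f 1 0 + f 1 1) := by ring
      rw [q1, q2] at k1
      have := k1.1
      have := k1.2
      linarith
  exact hle.csInf_eq

end
end
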